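/- arXiv:2507.22240 — 3 statements merged into one kernel-verified Lean document; each statement's English description precedes it below -/
import Mathlib

section
/- For all real numbers x, y with |x| ≤ 1/2, x² + y² ≥ 1 and y > 0, there exist A ∈ ℝ and L > 0 with |A| ≤ 2π and satisfying the spherical isoperimetric inequality L² ≥ 4π|A| + A², such that x = A/(4π) and y = L/(4π). In other words, the fundamental domain 𝒟 = {x + iy : |x| ≤ 1/2, x² + y² ≥ 1, y > 0} for the SL(2,ℤ)-action on the upper half-plane is contained in the region of moduli (A + iL)/(4π) of Hopf tori, where A is the signed area and L the length of a Jordan curve on S². -/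
open Real

/-- The fundamental domain `𝒟 = {x + iy : |x| ≤ 1/2, x² + y² ≥ 1, y > 0}` for the
`SL(2,ℤ)`-action on the upper half-plane is contained in the region of moduli
`(A + iL)/(4π)` of Hopf tori, where `|A| ≤ 2π` and `L² ≥ 4π|A| + A²` are the constraints
on the signed area `A` and length `L` of a Jordan curve on `S²`. -/
theorem fundamentalDomain_subset_hopf_moduli
    (x y : ℝ) (hx : |x| ≤ 1 / 2) (hxy : x ^ 2 + y ^ 2 ≥ 1) (hy : y > 0) :
    ∃ (A L : ℝ), L > 0 ∧ |A| ≤ 2 * π ∧ L ^ 2 ≥ 4 * π * |A| + A ^ 2 ∧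
      x = A / (4 * π) ∧ y = L / (4 * π) := by
  have hpi := pi_pos
  have key : |x| + x ^ 2 ≤ y ^ 2 := by
    nlinarith [abs_nonneg x, sq_abs x]
  have habs : |4 * π * x| = 4 * π * |x| := by
    rw [abs_mul, abs_of_pos (by positivity)]
  refine ⟨4 * π * x, 4 * π * y, by positivity, ?_, ?_, by field_simp, by field_simp⟩
  · rw [habs]
    nlinarith
  · rw [habs]
    nlinarith [mul_le_mul_of_nonneg_left key (sq_nonneg (4 * π))]
end

section
/- Let k be a positive integer. For all real numbers x, y with |x| ≤ 1/2, x² + y² ≥ 1 and y > 0, there exist A ∈ ℝ and L > 0 with |A| ≤ 2π and L² ≥ 4π|A| + A², such that x = kA/(4π) and y = L/(4π). In other words, the fundamental domain 𝒟 = {x + iy : |x| ≤ 1/2, x² + y² ≥ 1, y > 0} for the SL(2,ℤ)-action on the upper half-plane is contained in the image of the region {(A + iL)/(4π) : |A| ≤ 2π, L² ≥ 4π|A| + A²} under the homothety multiplying the real part by k. -/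
open Real

/-- For every positive integer `k`, the fundamental domain
`𝒟 = {x + iy : |x| ≤ 1/2, x² + y² ≥ 1, y > 0}` for the `SL(2,ℤ)`-action on the upper
half-plane is contained in the image of the Hopf-torus moduli region
`{(A + iL)/(4π) : |A| ≤ 2π, L² ≥ 4π|A| + A²}` under the homothety multiplying the
real part by `k` (moduli of tori from the `k`-th tensor power of the Hopf fibration). -/
theorem fundamentalDomain_subset_tensor_hopf_moduli
    (k : ℕ) (hk : 0 < k)
    (x y : ℝ) (hx : |x| ≤ 1 / 2) (hxy : x ^ 2 + y ^ 2 ≥ 1) (hy : y > 0) :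
    ∃ (A L : ℝ), L > 0 ∧ |A| ≤ 2 * π ∧ L ^ 2 ≥ 4 * π * |A| + A ^ 2 ∧
      x = (k : ℝ) * A / (4 * π) ∧ y = L / (4 * π) := by
  have hk0 : (0 : ℝ) < k := by exact_mod_cast hk
  have hk1 : (1 : ℝ) ≤ k := by exact_mod_cast hk
  have ht : |x / k| ≤ |x| := by
    rw [abs_div, abs_of_pos hk0]
    exact div_le_self (abs_nonneg x) hk1
  have hA : |4 * π * (x / k)| = 4 * π * |x / k| := by
    rw [abs_mul, abs_of_pos (by positivity)]
  have key : |x / k| + (x / k) ^ 2 ≤ y ^ 2 := by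
    rw [← sq_abs (x / k)]
    rw [← sq_abs x] at hxy
    nlinarith [abs_nonneg (x / k), abs_nonneg x]
  refine ⟨4 * π * (x / k), 4 * π * y, by positivity, ?_, ?_, ?_, ?_⟩
  · rw [hA]
    nlinarith [pi_pos]
  · rw [hA]
    nlinarith [mul_le_mul_of_nonneg_left key (by positivity : 0 ≤ 16 * π ^ 2)]
  · field_simp
  · field_simp
end

section
/- There exists a point τ of the upper half-plane ℍ such that for every t > 0 and every γ ∈ SL(2, ℤ), the image of the point i·t ∈ ℍ under the Möbius action of γ is not equal to τ. Equivalently, the SL(2,ℤ)-orbits of the purely imaginary points {i·t : t > 0} do not cover the upper half-plane, so the rectangular complex tori ℂ/(ℤ + i·tℤ) do not realize every conformal class of a compact genus-1 surface. -/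
open UpperHalfPlane

/-- The `SL(2,ℤ)`-orbits of the purely imaginary points `i·t` (`t > 0`) do not cover the
upper half-plane: there is a point `τ ∈ ℍ` which is not in the Möbius orbit of any `i·t`.
Equivalently, rectangular complex tori `ℂ/(ℤ + i·tℤ)` do not realize every conformal class
of a compact genus-1 surface. -/
theorem exists_not_in_orbit_of_imaginary_axis :
    ∃ τ : UpperHalfPlane, ∀ (t : ℝ) (ht : 0 < t)
      (γ : Matrix.SpecialLinearGroup (Fin 2) ℤ),
      γ • UpperHalfPlane.mk (Complex.I * t) (by simpa using ht) ≠ τ := by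
  -- The primitive sixth root of unity lies on no image of the imaginary axis, by parity.
  refine ⟨UpperHalfPlane.mk ⟨1 / 2, √3 / 2⟩ (by simp), fun t ht γ h ↦ ?_⟩
  have hdet := γ.det_coe
  rw [Matrix.det_fin_two] at hdet
  have hγ := congrArg UpperHalfPlane.coe h
  rw [coe_specialLinearGroup_apply] at hγ
  simp only [algebraMap_int_eq, eq_intCast, Complex.ofReal_intCast] at hγ
  generalize γ 0 0 = a, γ 0 1 = b, γ 1 0 = c, γ 1 1 = d at hdet hγ
  have hden : (c : ℂ) * (Complex.I * t) + d ≠ 0 := by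
    intro h0
    have hc := congrArg Complex.im h0
    have hd := congrArg Complex.re h0
    simp [ht.ne'] at hc hd
    simp [hc, hd] at hdet
  rw [div_eq_iff hden] at hγ
  have hre := congrArg Complex.re hγ
  have him := congrArg Complex.im hγ
  simp at hre him
  have hs : √3 ^ 2 = 3 := Real.sq_sqrt (by norm_num)
  have key : (a * d + b * c - 2 * c * d - 2 * a * b : ℝ) = 0 := by
    refine (mul_eq_zero.mp ?_).resolve_left ht.ne'
    linear_combination (d - 2 * b) * him + (t * c - 2 * (c * t / 2 + √3 / 2 * d)) * hre
      + t * c * d / 2 * hs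
  have key' : a * d + b * c - 2 * c * d - 2 * a * b = 0 := by exact_mod_cast key
  have : 2 * (b * c - c * d - a * b) = -1 := by linear_combination key' - hdet
  lia
end
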